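/- Let S be a finite index set with strictly positive real weights (w_i)_{i∈S}, let A ⊆ S, fix an integer k with 1 ≤ k ≤ |A|, let i, j ∈ A with i ≠ j, and regard the second-order inclusion probability π_{i,j} = w_i w_j R(k−2, A∖{i, j}) / R(k, A) as a function of the weight vector w on the positive orthant. Then ∂π_{i,j}/∂w_i = (π_{i,j}/w_i)(1 − π_i), where π_i = w_i R(k−1, A∖{i}) / R(k, A). -/

import Mathlib

open Finset

/-- The R-function: `R(k, A) = ∑_{B ⊆ A, |B| = k} ∏_{i ∈ B} w i`, with
`R(0, A) = 1` and `R(k, A) = 0` for `k < 0` or `k > |A|`. -/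
noncomputable def Rfun {ι : Type*} [DecidableEq ι] (w : ι → ℝ) (k : ℤ) (A : Finset ι) : ℝ :=
  if k < 0 then 0 else ∑ B ∈ A.powersetCard k.toNat, ∏ i ∈ B, w i

/-- First-order inclusion probability `π_i = w_i R(k−1, A∖{i}) / R(k, A)`. -/
noncomputable def incl1 {ι : Type*} [DecidableEq ι] (w : ι → ℝ) (k : ℤ) (A : Finset ι)
    (i : ι) : ℝ :=
  w i * Rfun w (k - 1) (A.erase i) / Rfun w k A

/-- Second-order inclusion probability `π_{i,j} = w_i w_j R(k−2, A∖{i,j}) / R(k, A)`. -/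
noncomputable def incl2 {ι : Type*} [DecidableEq ι] (w : ι → ℝ) (k : ℤ) (A : Finset ι)
    (i j : ι) : ℝ :=
  w i * w j * Rfun w (k - 2) ((A.erase i).erase j) / Rfun w k A

/-- `R(k, A)` does not depend on the weights outside `A`. -/
theorem Rfun_update_of_notMem {ι : Type*} [DecidableEq ι] (w : ι → ℝ) (k : ℤ) {A : Finset ι}
    {i : ι} (hi : i ∉ A) (t : ℝ) : Rfun (Function.update w i t) k A = Rfun w k A := by
  unfold Rfun
  refine if_congr Iff.rfl rfl (sum_congr rfl fun B hB => prod_congr rfl fun l hl => ?_)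
  exact Function.update_of_ne (ne_of_mem_of_not_mem ((mem_powersetCard.1 hB).1 hl) hi) t w

/-- The recursion `R(k, A) = R(k, A∖{i}) + w_i R(k−1, A∖{i})`. -/
theorem Rfun_eq_add_erase {ι : Type*} [DecidableEq ι] (w : ι → ℝ) {k : ℤ} (hk : 1 ≤ k)
    {A : Finset ι} {i : ι} (hi : i ∈ A) :
    Rfun w k A = Rfun w k (A.erase i) + w i * Rfun w (k - 1) (A.erase i) := by
  obtain ⟨n, rfl⟩ : ∃ n : ℕ, k = n + 1 := ⟨(k - 1).toNat, by omega⟩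
  have h₁ : ¬ ((n : ℤ) + 1 < 0) := by omega
  have h₂ : ((n : ℤ) + 1).toNat = n + 1 := by omega
  have h₃ : ¬ ((n : ℤ) < 0) := by omega
  simp only [Rfun, add_sub_cancel_right, h₁, h₂, h₃, if_false, Int.toNat_natCast]
  have hB : ∀ B ∈ (A.erase i).powersetCard n, i ∉ B := fun B hB h =>
    notMem_erase i A ((mem_powersetCard.1 hB).1 h)
  conv_lhs => rw [← insert_erase hi]
  rw [powersetCard_succ_insert (notMem_erase i A), sum_union, sum_image, mul_sum]
  · congr 1
    exact sum_congr rfl fun B h => prod_insert (hB B h)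
  · intro B h C h' hBC
    rw [← erase_insert (hB B h), ← erase_insert (hB C h')]
    exact congrArg (fun D => D.erase i) hBC
  · rw [disjoint_left]
    intro B h h'
    obtain ⟨C, -, rfl⟩ := mem_image.1 h'
    exact notMem_erase i A ((mem_powersetCard.1 h).1 (mem_insert_self i C))

/-- `R(k, A)` is positive for `0 ≤ k ≤ |A|` and positive weights. -/
theorem Rfun_pos {ι : Type*} [DecidableEq ι] {w : ι → ℝ} (hw : ∀ l, 0 < w l) {k : ℤ}
    {A : Finset ι} (hk : 0 ≤ k) (hkA : k ≤ (A.card : ℤ)) : 0 < Rfun w k A := by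
  rw [Rfun, if_neg hk.not_gt]
  exact sum_pos (fun B _ => prod_pos fun l _ => hw l) (powersetCard_nonempty.2 (by omega))

/-- on the positive orthant, for distinct `i, j ∈ A`,
`∂π_{i,j}/∂w_i = (π_{i,j}/w_i)(1 − π_i)`. -/
theorem stmt_7 {ι : Type*} [DecidableEq ι] (A : Finset ι) (k : ℤ)
    (hk1 : 1 ≤ k) (hk2 : k ≤ (A.card : ℤ))
    (w : ι → ℝ) (hw : ∀ l, 0 < w l) (i j : ι) (hi : i ∈ A) (hj : j ∈ A) (hij : i ≠ j) :
    HasDerivAt (fun t : ℝ => incl2 (Function.update w i t) k A i j)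
      (incl2 w k A i j / w i * (1 - incl1 w k A i)) (w i) := by
  have hR : Rfun w k A ≠ 0 := (Rfun_pos hw (by omega) hk2).ne'
  have hwi : w i ≠ 0 := (hw i).ne'
  have hrec := Rfun_eq_add_erase w hk1 hi
  have hfun : (fun t : ℝ => incl2 (Function.update w i t) k A i j) = fun t =>
      t * (w j * Rfun w (k - 2) ((A.erase i).erase j)) /
        (Rfun w k (A.erase i) + t * Rfun w (k - 1) (A.erase i)) := by
    funext t
    rw [incl2, Rfun_eq_add_erase _ hk1 hi, Function.update_self,
      Function.update_of_ne hij.symm, Rfun_update_of_notMem _ _ (notMem_erase i A),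
      Rfun_update_of_notMem _ _ (notMem_erase i A),
      Rfun_update_of_notMem _ _ (fun h => notMem_erase i A (mem_of_mem_erase h)), mul_assoc]
  rw [hfun]
  have hnum := (hasDerivAt_id' (w i)).mul_const (w j * Rfun w (k - 2) ((A.erase i).erase j))
  have hden := ((hasDerivAt_id' (w i)).mul_const (Rfun w (k - 1) (A.erase i))).const_add
    (Rfun w k (A.erase i))
  refine (hnum.fun_div hden (hrec ▸ hR)).congr_deriv ?_
  rw [← hrec, incl1, incl2]
  field_simp
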